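/- Let f : P¹_F → P¹_F be a cover of the projective line by itself with field of moduli M (F algebraically closed of characteristic zero). Then there exists a field extension L ⊇ M with [L : M] ≤ 2 such that f is defined over L. -/

import Mathlib

noncomputable section

variable {M F : Type} [Field M] [Field F] [Algebra M F]

/-- The natural action of a field automorphism `g` of `F` on rational functions
`F(t) = F(P¹)`: `g` acts through the coefficients of the numerator and denominator.
A rational function `f ∈ F(t)` of degree `≥ 1` is the same thing as a cover
`f : P¹_F → P¹_F`, and this action is the action `f ↦ g_* f` on such covers. -/
def galRat (g : F ≃ₐ[M] F) (f : RatFunc F) : RatFunc F :=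
  algebraMap (Polynomial F) (RatFunc F) (f.num.map g.toAlgHom.toRingHom) /
    algebraMap (Polynomial F) (RatFunc F) (f.denom.map g.toAlgHom.toRingHom)

/-- Composition of rational functions, i.e. composition `f ∘ m` of the corresponding
self-maps of `P¹_F`. -/
def ratComp (f m : RatFunc F) : RatFunc F :=
  RatFunc.eval (algebraMap F (RatFunc F)) m f

/-- `m ∈ F(t)` is a Möbius transformation `(a t + b)/(c t + d)`, `ad - bc ≠ 0`;
these are exactly the automorphisms of `P¹_F`. -/
def IsMobius (m : RatFunc F) : Prop :=
  ∃ a b c d : F, a * d - b * c ≠ 0 ∧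
    m = (RatFunc.C a * RatFunc.X + RatFunc.C b) / (RatFunc.C c * RatFunc.X + RatFunc.C d)

/-- Two covers `f, f' : P¹_F → P¹_F` are isomorphic iff they differ by an automorphism
of the source: `f ∘ m = f'` for some Möbius transformation `m`. -/
def RatCovIso (f f' : RatFunc F) : Prop :=
  ∃ m : RatFunc F, IsMobius m ∧ ratComp f m = f'

/-- The cover `f : P¹_F → P¹_F` is defined over the intermediate field `L`: it is
isomorphic (as a cover) to a rational function all of whose (normalized) numerator and
denominator coefficients lie in `L`. -/
def RatDefinedOver (L : IntermediateField M F) (f : RatFunc F) : Prop :=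
  ∃ f' : RatFunc F, RatCovIso f f' ∧
    (∀ n, f'.num.coeff n ∈ L) ∧ (∀ n, f'.denom.coeff n ∈ L)

/-! ### Galois descent -/

/-- An `M`-embedding of an intermediate field extends to an automorphism. -/
theorem exists_algEquiv_extending [Normal M F] (N : IntermediateField M F) (x : N →ₐ[M] F) :
    ∃ g : F ≃ₐ[M] F, ∀ n : N, g n = x n := by
  refine ⟨AlgEquiv.ofBijective (AlgHom.liftNormal x F)
    (Algebra.IsAlgebraic.algHom_bijective _), fun n => ?_⟩
  simpa using AlgHom.liftNormal_commutes x F n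

/-- Galois descent: a vector of a stable subspace `V` with open stabilizer is an `F`-linear
combination of invariant vectors of `V`. -/
theorem mem_span_invariants [Normal M F] {W : Type*} [AddCommGroup W] [Module F W]
    (ρ : (F ≃ₐ[M] F) → W →+ W) (hsemi : ∀ g (a : F) w, ρ g (a • w) = g a • ρ g w)
    (hmul : ∀ g h w, ρ (g * h) w = ρ g (ρ h w))
    (V : Submodule F W) (hV : ∀ g, ∀ v ∈ V, ρ g v ∈ V)
    (N : IntermediateField M F) [FiniteDimensional M N] {v : W} (hv : v ∈ V)
    (hN : ∀ g : F ≃ₐ[M] F, (∀ x ∈ N, g x = x) → ρ g v = v) :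
    v ∈ Submodule.span F {w | w ∈ V ∧ ∀ g, ρ g w = w} := by
  classical
  by_contra hcon
  obtain ⟨l, hl, hle⟩ := Submodule.exists_le_ker_of_notMem hcon
  apply hl
  choose s hs using exists_algEquiv_extending (M := M) (F := F) N
  let w : N → W := fun a => ∑ x : N →ₐ[M] F, ρ (s x) ((a : F) • v)
  have hcongr : ∀ (g h : F ≃ₐ[M] F), (∀ n : N, g n = h n) → ∀ a : N,
      ρ g ((a : F) • v) = ρ h ((a : F) • v) := by
    intro g h hgh a
    have h1 : ρ (h⁻¹ * g) v = v := by
      refine hN _ fun x hx => ?_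
      have := hgh ⟨x, hx⟩
      simp only [AlgEquiv.mul_apply] at this ⊢
      rw [this]
      exact h.symm_apply_apply x
    have h2 : g = h * (h⁻¹ * g) := by group
    rw [hsemi, hsemi, hgh a]
    conv_lhs => rw [h2, hmul, h1]
  have hw : ∀ a, w a ∈ V ∧ ∀ g, ρ g (w a) = w a := by
    intro a
    refine ⟨V.sum_mem fun x _ => hV _ _ (V.smul_mem _ hv), fun g => ?_⟩
    simp only [w, map_sum, ← hmul]
    let e : (N →ₐ[M] F) ≃ (N →ₐ[M] F) :=
      { toFun := fun x => (g : F →ₐ[M] F).comp x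
        invFun := fun x => ((g⁻¹ : F ≃ₐ[M] F) : F →ₐ[M] F).comp x
        left_inv := fun x => by ext n; exact g.symm_apply_apply _
        right_inv := fun x => by ext n; exact g.apply_symm_apply _ }
    rw [← Equiv.sum_comp e fun x => ρ (s x) ((a : F) • v)]
    refine Finset.sum_congr rfl fun x _ => hcongr _ _ (fun n => ?_) a
    rw [hs (e x) n, AlgEquiv.mul_apply, hs x n]
    rfl
  have hlin := linearIndependent_monoidHom N F
  have hlin' : LinearIndependent F fun x : N →ₐ[M] F => (⇑((x : N →* F)) : N → F) :=
    hlin.comp (fun x : N →ₐ[M] F => (x : N →* F)) fun x y hxy => by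
      ext n; exact DFunLike.congr_fun hxy n
  rw [Fintype.linearIndependent_iff] at hlin'
  have hzero : ∑ x : N →ₐ[M] F, l (ρ (s x) v) • (⇑((x : N →* F)) : N → F) = 0 := by
    funext a
    have h0 : l (w a) = 0 := hle (Submodule.subset_span (hw a))
    simp only [w, map_sum, hsemi, hs, map_smul, smul_eq_mul] at h0
    simpa [mul_comm] using h0
  have h1 := hlin' _ hzero N.val
  rwa [hN (s N.val) fun x hx => hs N.val ⟨x, hx⟩] at h1

/-- If `V₀` spans `W` over `F`, then some element of `V₀` avoids finitely many hyperplanes. -/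
theorem exists_mem_forall_apply_ne_zero [Infinite M] {W ι : Type*} [AddCommGroup W] [Module F W]
    [Module M W] [IsScalarTower M F W] (V₀ : Submodule M W)
    (hspan : Submodule.span F (V₀ : Set W) = ⊤) [Finite ι] (l : ι → W →ₗ[F] F)
    (hl : ∀ i, l i ≠ 0) : ∃ w ∈ V₀, ∀ i, l i w ≠ 0 := by
  by_contra! hcon
  obtain ⟨i, hi⟩ := Subspace.exists_eq_top_of_iUnion_eq_univ (k := M) (E := V₀)
    (p := fun i => LinearMap.ker (((l i).restrictScalars M).comp V₀.subtype)) (by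
      ext ⟨w, hw⟩
      simpa using hcon w hw)
  apply hl i
  have : (V₀ : Set W) ⊆ LinearMap.ker (l i) := by
    intro w hw
    have : (⟨w, hw⟩ : V₀) ∈ LinearMap.ker (((l i).restrictScalars M).comp V₀.subtype) := by
      rw [hi]; trivial
    simpa using this
  rw [← Submodule.span_le, hspan] at this
  ext w
  exact this (Submodule.mem_top)

/-! ### Degree two points on forms of the projective line -/

/-- A continuous cocycle in `PGL₂(F)`, given by matrices `c g`, has a point `u₀` of degree at
most two, which can be chosen outside any given finite set. -/
theorem exists_quadratic_point [IsGalois M F] [IsAlgClosed F] [Infinite M]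
    (c : (F ≃ₐ[M] F) → Matrix (Fin 2) (Fin 2) F) (hdet : ∀ g, (c g).det ≠ 0)
    (hmul : ∀ g h, ∃ s : F, c (g * h) = s • ((c h).map g * c g))
    (N : IntermediateField M F) [FiniteDimensional M N]
    (hN : ∀ g : F ≃ₐ[M] F, (∀ x ∈ N, g x = x) → ∃ s : F, c g = s • 1)
    {S : Set F} (hS : S.Finite) :
    ∃ L : IntermediateField M F, FiniteDimensional M L ∧ Module.finrank M L ≤ 2 ∧
      ∃ u₀ ∉ S, ∀ g : F ≃ₐ[M] F, (∀ x ∈ L, g x = x) →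
        c g 1 0 * u₀ + c g 1 1 ≠ 0 ∧
        c g 0 0 * u₀ + c g 0 1 = g u₀ * (c g 1 0 * u₀ + c g 1 1) := by
  classical
  have hunit : ∀ g, IsUnit (c g).det := fun g => (hdet g).isUnit
  let ρ : (F ≃ₐ[M] F) → Matrix (Fin 2) (Fin 2) F →+ Matrix (Fin 2) (Fin 2) F := fun g =>
    ((AddMonoidHom.mulLeft (c g)⁻¹).comp (AddMonoidHom.mulRight (c g))).comp
      (AddMonoidHom.mapMatrix (g : F →+ F))
  have hρ : ∀ g X, ρ g X = (c g)⁻¹ * (X.map g * c g) := fun g X => rfl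
  have hρ' : ∀ g X Y, ρ g X = Y ↔ X.map g * c g = c g * Y := by
    intro g X Y
    rw [hρ]
    constructor
    · rintro rfl
      rw [← Matrix.mul_assoc (c g), Matrix.mul_nonsing_inv _ (hunit g), Matrix.one_mul]
    · intro h
      rw [h, ← Matrix.mul_assoc, Matrix.nonsing_inv_mul _ (hunit g), Matrix.one_mul]
  have hsemi : ∀ g (a : F) X, ρ g (a • X) = g a • ρ g X := by
    intro g a X
    rw [hρ, hρ, ← Matrix.mul_smul, ← Matrix.smul_mul]
    congr 2
    ext i j
    simp
  have hcomp : ∀ g h X, ρ (g * h) X = ρ g (ρ h X) := by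
    intro g h X
    obtain ⟨s, hs⟩ := hmul g h
    rw [hρ']
    have h1 := (hρ' h X _).1 rfl
    have h2 := (hρ' g (ρ h X) _).1 rfl
    have h3 := congrArg (fun Y => Matrix.map Y g) h1
    simp only [Matrix.map_mul] at h3
    have h4 : (X.map (g * h : F ≃ₐ[M] F)) = (X.map h).map g := by ext; simp
    rw [hs, h4, Matrix.mul_smul, ← Matrix.mul_assoc, h3, Matrix.mul_assoc, h2, Matrix.smul_mul,
      Matrix.mul_assoc]
  let V₀ : Submodule M (Matrix (Fin 2) (Fin 2) F) :=
    { carrier := {X | ∀ g, ρ g X = X}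
      add_mem' := fun {X Y} hX hY g => by rw [map_add, hX g, hY g]
      zero_mem' := fun g => map_zero _
      smul_mem' := fun m X hX g => by
        rw [← IsScalarTower.algebraMap_smul F m X, hsemi, hX g, AlgEquiv.commutes] }
  have hspan : Submodule.span F (V₀ : Set (Matrix (Fin 2) (Fin 2) F)) = ⊤ := by
    rw [eq_top_iff, ← (Matrix.stdBasis F (Fin 2) (Fin 2)).span_eq, Submodule.span_le]
    rintro _ ⟨⟨i, j⟩, rfl⟩
    have := mem_span_invariants ρ hsemi hcomp ⊤ (fun _ _ _ => trivial) N
      (v := Matrix.stdBasis F (Fin 2) (Fin 2) (i, j)) trivial (fun g hg => by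
        obtain ⟨s, hs⟩ := hN g hg
        rw [hρ', hs]
        simp [Matrix.stdBasis_eq_single])
    exact Submodule.span_mono (fun w hw => hw.2) this
  let ℓ : Option S → Matrix (Fin 2) (Fin 2) F →ₗ[F] F
    | none => Matrix.entryLinearMap F F 1 0
    | some s => (s : F) • Matrix.entryLinearMap F F 0 0 + Matrix.entryLinearMap F F 0 1 -
        ((s : F) * s) • Matrix.entryLinearMap F F 1 0 - (s : F) • Matrix.entryLinearMap F F 1 1
  have hℓ : ∀ i, ℓ i ≠ 0 := by
    rintro (_ | s) h0
    · simpa [ℓ] using LinearMap.congr_fun h0 !![0, 0; 1, 0]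
    · simpa [ℓ] using LinearMap.congr_fun h0 !![0, 1; 0, 0]
  have : Finite S := hS
  obtain ⟨X, hX, hXℓ⟩ := exists_mem_forall_apply_ne_zero V₀ hspan ℓ hℓ
  have hXg : ∀ g : F ≃ₐ[M] F, X.map g * c g = c g * X := fun g => (hρ' g X X).1 (hX g)
  have hX10 : X 1 0 ≠ 0 := hXℓ none
  have hXS : ∀ s ∈ S, s * X 0 0 + X 0 1 - s * s * X 1 0 - s * X 1 1 ≠ 0 := by
    intro s hs
    simpa [ℓ] using hXℓ (some ⟨s, hs⟩)
  have htr : ∀ g : F ≃ₐ[M] F, g X.trace = X.trace := by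
    intro g
    have h1 : X.map g = c g * X * (c g)⁻¹ := by
      rw [← hXg, Matrix.mul_assoc, Matrix.mul_nonsing_inv _ (hunit g), Matrix.mul_one]
    have h2 : g X.trace = (X.map g).trace := by simp [Matrix.trace]
    rw [h2, h1, Matrix.trace_mul_comm, ← Matrix.mul_assoc, Matrix.nonsing_inv_mul _ (hunit g),
      Matrix.one_mul]
  have hdt : ∀ g : F ≃ₐ[M] F, g X.det = X.det := by
    intro g
    have h1 := congrArg Matrix.det (hXg g)
    rw [Matrix.det_mul, Matrix.det_mul, mul_comm] at h1
    have h2 : (X.map g).det = g X.det := by simp [Matrix.det_fin_two]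
    rw [← h2]
    exact mul_left_cancel₀ (hdet g) h1
  obtain ⟨t, ht⟩ := (InfiniteGalois.mem_range_algebraMap_iff_fixed (k := M) _).2 htr
  obtain ⟨d, hd⟩ := (InfiniteGalois.mem_range_algebraMap_iff_fixed (k := M) _).2 hdt
  let P : Polynomial M := Polynomial.C 1 * Polynomial.X ^ 2 + Polynomial.C (-t) * Polynomial.X +
    Polynomial.C d
  have hPdeg : P.natDegree = 2 := Polynomial.natDegree_quadratic one_ne_zero
  have hP0 : P ≠ 0 := fun h => by simp [h] at hPdeg
  obtain ⟨lam, hlam⟩ := IsAlgClosed.exists_aeval_eq_zero F P (by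
    rw [Polynomial.degree_eq_natDegree hP0, hPdeg]; norm_num)
  have hquad : lam ^ 2 - (X 0 0 + X 1 1) * lam + (X 0 0 * X 1 1 - X 0 1 * X 1 0) = 0 := by
    rw [← Matrix.det_fin_two, ← Matrix.trace_fin_two, ← ht, ← hd]
    simp [P] at hlam
    linear_combination hlam
  have hint : IsIntegral M lam := Algebra.IsIntegral.isIntegral lam
  refine ⟨IntermediateField.adjoin M {lam}, IntermediateField.adjoin.finiteDimensional hint, ?_,
    (lam - X 1 1) / X 1 0, ?_, ?_⟩
  · rw [IntermediateField.adjoin.finrank hint, ← hPdeg]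
    exact Polynomial.natDegree_le_of_dvd (minpoly.dvd M lam hlam) hP0
  · intro hmem
    apply hXS _ hmem
    field_simp
    linear_combination -hquad
  · intro g hg
    have hglam : g lam = lam := hg _ (IntermediateField.mem_adjoin_simple_self M lam)
    have h00 := congrFun (congrFun (hXg g) 0) 0
    have h01 := congrFun (congrFun (hXg g) 0) 1
    have h10 := congrFun (congrFun (hXg g) 1) 0
    have h11 := congrFun (congrFun (hXg g) 1) 1
    simp only [Matrix.mul_apply, Fin.sum_univ_two, Matrix.map_apply] at h00 h01 h10 h11
    have hd := hdet g
    rw [Matrix.det_fin_two] at hd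
    have hgX : g (X 1 0) ≠ 0 := by simpa using hX10
    set u := (lam - X 1 1) / X 1 0 with hu
    have hu1 : X 1 0 * u = lam - X 1 1 := by rw [hu]; field_simp
    have hu0 : X 0 0 * u + X 0 1 = lam * u := by
      rw [hu]; field_simp; linear_combination -hquad
    have hgu : g (X 1 0) * g u = lam - g (X 1 1) := by
      rw [← map_mul, hu1, map_sub, hglam]
    have hkey : g (X 1 0) * (c g 0 0 * u + c g 0 1) =
        g (X 1 0) * g u * (c g 1 0 * u + c g 1 1) := by
      rw [hgu]
      linear_combination u * h10 + h11 + c g 1 0 * hu0 + c g 1 1 * hu1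
    have hkey' : c g 0 0 * u + c g 0 1 = g u * (c g 1 0 * u + c g 1 1) :=
      mul_left_cancel₀ hgX (by rw [hkey]; ring)
    refine ⟨fun h0 => hd ?_, hkey'⟩
    rw [h0, mul_zero] at hkey'
    linear_combination c g 0 0 * h0 - c g 1 0 * hkey'

/-! ### Semilinear ring homomorphisms of the rational function field -/

/-- A ring homomorphism of `F(t)` which acts on the constants through `g`. -/
def IsSemilin (g : F → F) (σ : RatFunc F → RatFunc F) : Prop :=
  ∀ a, σ (RatFunc.C a) = RatFunc.C (g a)

theorem IsSemilin.map_polynomial {g : F →+* F} {σ : RatFunc F →+* RatFunc F} (hσ : IsSemilin g σ)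
    (p : Polynomial F) :
    σ (algebraMap _ _ p) = p.eval₂ (RatFunc.C.comp g) (σ RatFunc.X) := by
  have : σ.comp (algebraMap (Polynomial F) (RatFunc F)) =
      Polynomial.eval₂RingHom (RatFunc.C.comp g) (σ RatFunc.X) := by
    ext a
    · simpa using hσ a
    · simp
  exact RingHom.congr_fun this p

theorem IsSemilin.apply_eq {g : F →+* F} {σ : RatFunc F →+* RatFunc F} (hσ : IsSemilin g σ)
    (h : RatFunc F) :
    σ h = h.num.eval₂ (RatFunc.C.comp g) (σ RatFunc.X) /
      h.denom.eval₂ (RatFunc.C.comp g) (σ RatFunc.X) := by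
  conv_lhs => rw [← RatFunc.num_div_denom h]
  rw [map_div₀, hσ.map_polynomial, hσ.map_polynomial]

theorem IsSemilin.ext {g : F →+* F} {σ τ : RatFunc F →+* RatFunc F} (hσ : IsSemilin g σ)
    (hτ : IsSemilin g τ) (hX : σ RatFunc.X = τ RatFunc.X) (h : RatFunc F) : σ h = τ h := by
  rw [hσ.apply_eq, hτ.apply_eq, hX]

theorem IsSemilin.ratComp_eq {σ : RatFunc F →+* RatFunc F} (hσ : IsSemilin id σ) (h : RatFunc F) :
    ratComp h (σ RatFunc.X) = σ h := by
  have hσ' : IsSemilin (RingHom.id F) σ := hσ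
  rw [hσ'.apply_eq h, ratComp, RatFunc.eval]
  rfl

theorem IsSemilin.ratComp_galRat {g : F ≃ₐ[M] F} {σ τ : RatFunc F →+* RatFunc F}
    (hσ : IsSemilin g σ) (hτ : IsSemilin id τ) (hX : τ RatFunc.X = σ RatFunc.X) (h : RatFunc F) :
    ratComp (galRat g h) (σ RatFunc.X) = σ h := by
  have hσ' : IsSemilin (g.toAlgHom.toRingHom) σ := hσ
  have hτ' : IsSemilin (RingHom.id F) τ := hτ
  rw [← hX, hτ.ratComp_eq, galRat, map_div₀, hτ'.map_polynomial, hτ'.map_polynomial,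
    Polynomial.eval₂_map, Polynomial.eval₂_map, hσ'.apply_eq, hX]
  rfl

theorem exists_semilin (g : F →+* F) {m : RatFunc F} (hm : ¬ ∃ c, m = RatFunc.C c) :
    ∃ σ : RatFunc F →+* RatFunc F, IsSemilin g σ ∧ σ RatFunc.X = m := by
  have htr := RatFunc.transcendental_of_ne_C m hm
  have hinj : Function.Injective (Polynomial.eval₂RingHom (RatFunc.C.comp g) m) := by
    rw [injective_iff_map_eq_zero]
    intro p hp
    rw [transcendental_iff] at htr
    have h1 : Polynomial.aeval m (p.map g) = 0 := by
      rw [Polynomial.aeval_def, Polynomial.eval₂_map]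
      exact hp
    exact (Polynomial.map_eq_zero g).1 (htr _ h1)
  have hle : nonZeroDivisors (Polynomial F) ≤ (nonZeroDivisors (RatFunc F)).comap
      (Polynomial.eval₂RingHom (RatFunc.C.comp g) m) :=
    nonZeroDivisors_le_comap_nonZeroDivisors_of_injective _ hinj
  refine ⟨RatFunc.liftRingHom _ hle, fun a => ?_, ?_⟩
  · rw [RatFunc.liftRingHom_C]; simp
  · rw [RatFunc.liftRingHom_X]; simp

theorem C_mul_X_add_C_ne_zero {c d : F} (h : c ≠ 0 ∨ d ≠ 0) :
    RatFunc.C c * RatFunc.X + RatFunc.C d ≠ (0 : RatFunc F) := by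
  intro h0
  have h1 : algebraMap (Polynomial F) (RatFunc F)
      (Polynomial.C c * Polynomial.X + Polynomial.C d) = 0 := by simpa using h0
  rw [map_eq_zero_iff _ (RatFunc.algebraMap_injective F)] at h1
  have hc : c = 0 := by simpa using congrArg (Polynomial.coeff · 1) h1
  have hd : d = 0 := by simpa using congrArg (Polynomial.coeff · 0) h1
  tauto

theorem IsMobius.not_const {m : RatFunc F} (hm : IsMobius m) : ¬ ∃ c, m = RatFunc.C c := by
  rintro ⟨k, rfl⟩
  obtain ⟨a, b, c, d, hdet, hm⟩ := hm
  have hden : RatFunc.C c * RatFunc.X + RatFunc.C d ≠ (0 : RatFunc F) :=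
    C_mul_X_add_C_ne_zero (by by_contra! h; exact hdet (by rw [h.1, h.2]; ring))
  rw [eq_div_iff hden] at hm
  have h1 : algebraMap (Polynomial F) (RatFunc F)
      (Polynomial.C k * (Polynomial.C c * Polynomial.X + Polynomial.C d)) =
      algebraMap (Polynomial F) (RatFunc F) (Polynomial.C a * Polynomial.X + Polynomial.C b) := by
    simpa using hm
  have h2 := RatFunc.algebraMap_injective F h1
  have hc : k * c = a := by simpa using congrArg (Polynomial.coeff · 1) h2
  have hd : k * d = b := by simpa using congrArg (Polynomial.coeff · 0) h2
  exact hdet (by rw [← hc, ← hd]; ring)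

theorem isMobius_X : IsMobius (RatFunc.X : RatFunc F) := ⟨1, 0, 0, 1, by simp, by simp⟩

theorem not_X_eq_C : ¬ ∃ c : F, RatFunc.X = RatFunc.C c := isMobius_X.not_const

theorem X_sub_C_ne_zero (P : F) : RatFunc.X - RatFunc.C P ≠ 0 := fun h =>
  not_X_eq_C ⟨P, sub_eq_zero.1 h⟩

theorem exists_semilin_equiv (g : F ≃+* F) {m : RatFunc F} (hm : IsMobius m) :
    ∃ σ : RatFunc F ≃+* RatFunc F, IsSemilin g σ ∧ σ RatFunc.X = m := by
  obtain ⟨σ, hσ, hX⟩ := exists_semilin (g : F →+* F) hm.not_const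
  obtain ⟨a, b, c, d, hdet, hm'⟩ := hm
  have hC : ∀ k : F, RatFunc.C k ∈ σ.fieldRange := fun k =>
    ⟨RatFunc.C (g.symm k), by rw [hσ]; simp⟩
  have hden : RatFunc.C c * RatFunc.X + RatFunc.C d ≠ (0 : RatFunc F) :=
    C_mul_X_add_C_ne_zero (by by_contra! h; exact hdet (by rw [h.1, h.2]; ring))
  have hmden : RatFunc.C a - RatFunc.C c * m ≠ 0 := by
    intro h0
    rw [hm', sub_eq_zero, ← mul_div_assoc, eq_div_iff hden] at h0
    have : RatFunc.C (a * d - b * c) = 0 := by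
      simp only [map_sub, map_mul]
      linear_combination h0
    exact hdet ((map_eq_zero _).1 this)
  have hXmem : RatFunc.X ∈ σ.fieldRange := by
    have : RatFunc.X = (RatFunc.C d * m - RatFunc.C b) / (RatFunc.C a - RatFunc.C c * m) := by
      rw [eq_div_iff hmden]
      rw [eq_div_iff hden] at hm'
      linear_combination -hm'
    rw [this]
    have hmm : m ∈ σ.fieldRange := ⟨_, hX⟩
    exact div_mem (sub_mem (mul_mem (hC _) hmm) (hC _)) (sub_mem (hC _) (mul_mem (hC _) hmm))
  have hpoly : ∀ p : Polynomial F, algebraMap _ (RatFunc F) p ∈ σ.fieldRange := by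
    intro p
    induction p using Polynomial.induction_on' with
    | add p q hp hq => rw [map_add]; exact add_mem hp hq
    | monomial n k =>
      rw [RatFunc.algebraMap_monomial]
      exact mul_mem (hC k) (pow_mem hXmem n)
  have hsurj : Function.Surjective σ := by
    intro h
    have : h ∈ σ.fieldRange := by
      rw [← RatFunc.num_div_denom h]; exact div_mem (hpoly _) (hpoly _)
    exact this
  exact ⟨RingEquiv.ofBijective σ ⟨σ.injective, hsurj⟩, hσ, hX⟩

theorem exists_semilin_equiv_X (g : F ≃+* F) :
    ∃ σ : RatFunc F ≃+* RatFunc F, IsSemilin g σ ∧ σ RatFunc.X = RatFunc.X :=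
  exists_semilin_equiv g isMobius_X

theorem isMobius_of_adjoin_eq_top {m : RatFunc F} (h : IntermediateField.adjoin F {m} = ⊤) :
    IsMobius m := by
  have hmax : max m.num.natDegree m.denom.natDegree = 1 := by
    rw [← RatFunc.finrank_eq_max_natDegree, h, IntermediateField.finrank_top]
  obtain ⟨a, b, hn⟩ := Polynomial.exists_eq_X_add_C_of_natDegree_le_one
    (show m.num.natDegree ≤ 1 by omega)
  obtain ⟨c, d, hd⟩ := Polynomial.exists_eq_X_add_C_of_natDegree_le_one
    (show m.denom.natDegree ≤ 1 by omega)
  refine ⟨a, b, c, d, fun hdet => ?_, ?_⟩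
  · have hrel : Polynomial.C c * m.num = Polynomial.C a * m.denom := by
      have : Polynomial.C a * Polynomial.C d = Polynomial.C b * Polynomial.C c := by
        rw [← map_mul, ← map_mul, sub_eq_zero.1 hdet]
      rw [hn, hd]
      linear_combination -this
    have hcop := m.isCoprime_num_denom
    have hdn : m.num.natDegree = 1 → a ≠ 0 := by
      rintro h1 rfl
      rw [hn] at h1; simp at h1
    have hdd : m.denom.natDegree = 1 → c ≠ 0 := by
      rintro h1 rfl
      rw [hd] at h1; simp at h1
    have hc0 : c = 0 := by
      by_contra hc
      have hdvd : m.denom ∣ m.num := by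
        have hu : IsUnit (Polynomial.C c) := Polynomial.isUnit_C.2 (Ne.isUnit hc)
        exact (hu.dvd_mul_left).1 (hrel ▸ Dvd.intro_left _ rfl)
      have := Polynomial.natDegree_eq_zero_of_isUnit (hcop.symm.isUnit_of_dvd' dvd_rfl hdvd)
      rw [hd] at this
      have h2 := Polynomial.natDegree_linear (b := d) hc
      omega
    have ha0 : a = 0 := by
      by_contra ha
      rw [hc0, map_zero, zero_mul] at hrel
      exact (mul_ne_zero (Polynomial.C_ne_zero.2 ha) m.denom_ne_zero) hrel.symm
    by_cases h1 : m.num.natDegree = 1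
    · exact hdn h1 ha0
    · exact hdd (by omega) hc0
  · conv_lhs => rw [← RatFunc.num_div_denom m, hn, hd]
    simp

theorem IsSemilin.isMobius {g : F →+* F} {σ : RatFunc F →+* RatFunc F} (hσ : IsSemilin g σ)
    (hsurj : Function.Surjective σ) : IsMobius (σ RatFunc.X) := by
  apply isMobius_of_adjoin_eq_top
  rw [eq_top_iff]
  intro h _
  obtain ⟨k, rfl⟩ := hsurj h
  have hpoly : ∀ p : Polynomial F, p.eval₂ (RatFunc.C.comp g) (σ RatFunc.X) ∈
      IntermediateField.adjoin F {σ RatFunc.X} := by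
    intro p
    rw [← Polynomial.eval₂_map, ← RatFunc.algebraMap_eq_C, ← Polynomial.aeval_def]
    exact IntermediateField.algebra_adjoin_le_adjoin F _ (Polynomial.aeval_mem_adjoin_singleton F _)
  rw [hσ.apply_eq k]
  exact div_mem (hpoly _) (hpoly _)

theorem IsSemilin.map_num_denom {g : F →+* F} {σ : RatFunc F →+* RatFunc F} (hσ : IsSemilin g σ)
    (hX : σ RatFunc.X = RatFunc.X) {h : RatFunc F} (hh : σ h = h) :
    h.num.map g = h.num ∧ h.denom.map g = h.denom := by
  have hpoly : ∀ p : Polynomial F, σ (algebraMap _ _ p) = algebraMap _ _ (p.map g) := by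
    intro p
    rw [hσ.map_polynomial, hX, ← RatFunc.aeval_X_left_eq_algebraMap, Polynomial.aeval_def,
      Polynomial.eval₂_map]
    rfl
  have hne : (h.denom.map g) ≠ 0 := (h.monic_denom.map g).ne_zero
  have h1 : h.num * h.denom.map g = h.num.map g * h.denom := by
    rw [RatFunc.num_mul_eq_mul_denom_iff hne, ← hpoly, ← hpoly, ← map_div₀,
      RatFunc.num_div_denom, hh]
  have hdvd : h.denom ∣ h.denom.map g :=
    h.isCoprime_num_denom.symm.dvd_of_dvd_mul_left (Dvd.intro_left _ h1.symm)
  have hd : h.denom.map g = h.denom := by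
    exact Polynomial.eq_of_monic_of_dvd_of_natDegree_le h.monic_denom (h.monic_denom.map g)
      hdvd Polynomial.natDegree_map_le
  refine ⟨?_, hd⟩
  rw [hd] at h1
  exact (mul_right_cancel₀ h.denom_ne_zero h1).symm

/-- A rational function has its coefficients in a finite extension of the base field. -/
theorem exists_finiteDimensional_fixing [Algebra.IsAlgebraic M F] (h : RatFunc F) :
    ∃ N : IntermediateField M F, FiniteDimensional M N ∧
      ∀ (g : F ≃ₐ[M] F) (σ : RatFunc F →+* RatFunc F), (∀ x ∈ N, g x = x) → IsSemilin g σ →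
        σ RatFunc.X = RatFunc.X → σ h = h := by
  classical
  let T : Finset F := h.num.coeffs ∪ h.denom.coeffs
  refine ⟨IntermediateField.adjoin M (T : Set F), ?_, fun g σ hg hσ hX => ?_⟩
  · exact IntermediateField.finiteDimensional_adjoin fun x _ => Algebra.IsIntegral.isIntegral x
  · have hσ' : IsSemilin (g : F →+* F) σ := hσ
    have hpoly : ∀ p : Polynomial F, p.coeffs ⊆ T →
        p.eval₂ (RatFunc.C.comp (g : F →+* F)) RatFunc.X = algebraMap _ (RatFunc F) p := by
      intro p hp
      rw [← RatFunc.aeval_X_left_eq_algebraMap, Polynomial.aeval_def, Polynomial.eval₂_eq_sum,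
        Polynomial.eval₂_eq_sum, Polynomial.sum, Polynomial.sum]
      refine Finset.sum_congr rfl fun i hi => ?_
      have : g (p.coeff i) = p.coeff i := hg _ (IntermediateField.subset_adjoin _ _
        (hp (Polynomial.coeff_mem_coeffs (Polynomial.mem_support_iff.1 hi))))
      simp [this]
    rw [hσ'.apply_eq, hX, hpoly _ Finset.subset_union_left, hpoly _ Finset.subset_union_right,
      RatFunc.num_div_denom]

/-! ### Values of rational functions at finite points -/

/-- The rational function `h` is regular at `P` and takes the value `c` there. -/
def HasVal (P : F) (h : RatFunc F) (c : F) : Prop :=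
  ∃ p q : Polynomial F, q.eval P ≠ 0 ∧ h * algebraMap _ _ q = algebraMap _ _ p ∧
    p.eval P = c * q.eval P

theorem HasVal.unique {P : F} {h : RatFunc F} {c d : F} (h1 : HasVal P h c) (h2 : HasVal P h d) :
    c = d := by
  obtain ⟨p, q, hq, hpq, hv⟩ := h1
  obtain ⟨p', q', hq', hpq', hv'⟩ := h2
  have h3 : algebraMap (Polynomial F) (RatFunc F) (p * q') = algebraMap _ _ (p' * q) := by
    rw [map_mul, map_mul, ← hpq, ← hpq']; ring
  have h4 := congrArg (Polynomial.eval P) (RatFunc.algebraMap_injective F h3)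
  rw [Polynomial.eval_mul, Polynomial.eval_mul, hv, hv'] at h4
  apply mul_right_cancel₀ (mul_ne_zero hq hq')
  linear_combination h4

theorem HasVal.const (P a : F) : HasVal P (RatFunc.C a) a :=
  ⟨Polynomial.C a, 1, by simp, by simp, by simp⟩

theorem HasVal.X (P : F) : HasVal P RatFunc.X P :=
  ⟨Polynomial.X, 1, by simp, by simp, by simp⟩

theorem HasVal.add {P : F} {h k : RatFunc F} {c d : F} (h1 : HasVal P h c) (h2 : HasVal P k d) :
    HasVal P (h + k) (c + d) := by
  obtain ⟨p, q, hq, hpq, hv⟩ := h1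
  obtain ⟨p', q', hq', hpq', hv'⟩ := h2
  refine ⟨p * q' + p' * q, q * q', by simp [hq, hq'], ?_, ?_⟩
  · simp only [map_mul, map_add, ← hpq, ← hpq']; ring
  · simp only [Polynomial.eval_add, Polynomial.eval_mul, hv, hv']; ring

theorem HasVal.mul {P : F} {h k : RatFunc F} {c d : F} (h1 : HasVal P h c) (h2 : HasVal P k d) :
    HasVal P (h * k) (c * d) := by
  obtain ⟨p, q, hq, hpq, hv⟩ := h1
  obtain ⟨p', q', hq', hpq', hv'⟩ := h2
  refine ⟨p * p', q * q', by simp [hq, hq'], ?_, ?_⟩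
  · simp only [map_mul, ← hpq, ← hpq']; ring
  · simp only [Polynomial.eval_mul, hv, hv']; ring

theorem HasVal.sub {P : F} {h k : RatFunc F} {c d : F} (h1 : HasVal P h c) (h2 : HasVal P k d) :
    HasVal P (h - k) (c - d) := by
  have := h1.add ((HasVal.const P (-1)).mul h2)
  simpa [sub_eq_add_neg] using this

theorem HasVal.of_sub {P c : F} {h : RatFunc F} (h1 : HasVal P (h - RatFunc.C c) 0) :
    HasVal P h c := by
  simpa using h1.add (HasVal.const P c)

theorem HasVal.of_mul_eq {P : F} {h x y : RatFunc F} {c d : F} (hx : HasVal P x c)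
    (hy : HasVal P y d) (hd : d ≠ 0) (hxy : h * y = x) : HasVal P h (c / d) := by
  obtain ⟨p, q, hq, hpq, hv⟩ := hx
  obtain ⟨p', q', hq', hpq', hv'⟩ := hy
  refine ⟨p * q', p' * q, ?_, ?_, ?_⟩
  · rw [Polynomial.eval_mul, hv']; exact mul_ne_zero (mul_ne_zero hd hq') hq
  · simp only [map_mul, ← hpq, ← hpq', ← hxy]; ring
  · simp only [Polynomial.eval_mul, hv, hv']; field_simp

theorem HasVal.of_denom_ne_zero {P : F} {h : RatFunc F} (hP : h.denom.eval P ≠ 0) :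
    HasVal P h (h.num.eval P / h.denom.eval P) := by
  refine ⟨h.num, h.denom, hP, ?_, by field_simp⟩
  conv_lhs => enter [1]; rw [← RatFunc.num_div_denom h]
  exact div_mul_cancel₀ _ (RatFunc.algebraMap_ne_zero h.denom_ne_zero)

theorem hasVal_or_inv (P : F) (h : RatFunc F) :
    (∃ c, HasVal P h c) ∨ h ≠ 0 ∧ HasVal P h⁻¹ 0 := by
  by_cases hP : h.denom.eval P = 0
  · have hn : h.num.eval P ≠ 0 := by
      intro hn
      obtain ⟨a, b, hab⟩ := h.isCoprime_num_denom
      simpa [hn, hP] using congrArg (Polynomial.eval P) hab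
    have h0 : h ≠ 0 := by rintro rfl; simp at hn
    refine .inr ⟨h0, h.denom, h.num, hn, ?_, by simp [hP]⟩
    rw [inv_mul_eq_iff_eq_mul₀ h0, ← div_eq_iff (RatFunc.algebraMap_ne_zero h.denom_ne_zero),
      RatFunc.num_div_denom]
  · exact .inl ⟨_, .of_denom_ne_zero hP⟩

theorem not_hasVal_inv {P : F} {h : RatFunc F} {c : F} (h1 : HasVal P h 0) (hh : h ≠ 0) :
    ¬ HasVal P h⁻¹ c := by
  intro h2
  have h3 := h1.mul h2
  rw [mul_inv_cancel₀ hh, zero_mul] at h3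
  exact one_ne_zero ((HasVal.const P 1).unique (by simpa using h3))

theorem HasVal.of_mul_eq_zero {P : F} {h k : RatFunc F} (h1 : HasVal P (h * k) 0) :
    HasVal P h 0 ∨ HasVal P k 0 := by
  by_cases hh : h = 0
  · left; rw [hh]; simpa using HasVal.const P 0
  by_cases hk : k = 0
  · right; rw [hk]; simpa using HasVal.const P 0
  by_contra! hcon
  have hinv : ∀ {x : RatFunc F}, x ≠ 0 → ¬ HasVal P x 0 → ∃ c, HasVal P x⁻¹ c := by
    intro x hx hx0
    obtain ⟨c, hc⟩ | ⟨-, hc⟩ := hasVal_or_inv P x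
    · have hc0 : c ≠ 0 := by rintro rfl; exact hx0 hc
      exact ⟨_, (HasVal.const P 1).of_mul_eq hc hc0 (by simp [hx])⟩
    · exact ⟨_, hc⟩
  obtain ⟨c, hc⟩ := hinv hh hcon.1
  obtain ⟨d, hd⟩ := hinv hk hcon.2
  refine not_hasVal_inv h1 (mul_ne_zero hh hk) ?_ (c := c * d)
  rw [mul_inv]
  exact hc.mul hd

theorem HasVal.exists_of_prod_eq_zero {ι : Type*} {P : F} (s : Finset ι) {h : ι → RatFunc F}
    (h1 : HasVal P (∏ i ∈ s, h i) 0) : ∃ i ∈ s, HasVal P (h i) 0 := by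
  classical
  induction s using Finset.induction_on with
  | empty =>
    rw [Finset.prod_empty] at h1
    exact absurd ((HasVal.const P 1).unique (by simpa using h1)) one_ne_zero
  | insert i s hi ih =>
    rw [Finset.prod_insert hi] at h1
    obtain h2 | h2 := h1.of_mul_eq_zero
    · exact ⟨i, Finset.mem_insert_self _ _, h2⟩
    · obtain ⟨j, hj, hv⟩ := ih h2
      exact ⟨j, Finset.mem_insert_of_mem hj, hv⟩

theorem HasVal.exists_prod {ι : Type*} {P : F} (s : Finset ι) {h : ι → RatFunc F}
    (h1 : ∀ i ∈ s, ∃ c, HasVal P (h i) c) : ∃ c, HasVal P (∏ i ∈ s, h i) c := by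
  classical
  induction s using Finset.induction_on with
  | empty => exact ⟨1, by simpa using HasVal.const P 1⟩
  | insert i s hi ih =>
    rw [Finset.prod_insert hi]
    obtain ⟨c, hc⟩ := h1 i (Finset.mem_insert_self _ _)
    obtain ⟨d, hd⟩ := ih fun j hj => h1 j (Finset.mem_insert_of_mem hj)
    exact ⟨_, hc.mul hd⟩

theorem HasVal.exists_prod_eq_zero {ι : Type*} {P : F} {s : Finset ι} {h : ι → RatFunc F}
    (h1 : ∀ i ∈ s, ∃ c, HasVal P (h i) c) {j : ι} (hj : j ∈ s) (hj0 : HasVal P (h j) 0) :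
    HasVal P (∏ i ∈ s, h i) 0 := by
  classical
  rw [← Finset.mul_prod_erase s h hj]
  obtain ⟨c, hc⟩ := HasVal.exists_prod (s.erase j) fun i hi => h1 i (Finset.mem_of_mem_erase hi)
  simpa using hj0.mul hc

/-- A semilinear homomorphism whose value at `t` takes the value `g R` at `P` carries values at
`R` to values at `P`. -/
theorem HasVal.semilin {g : F →+* F} {σ : RatFunc F →+* RatFunc F} (hσ : IsSemilin g σ)
    {P R c : F} (hX : HasVal P (σ RatFunc.X) (g R)) {h : RatFunc F} (hh : HasVal R h c) :
    HasVal P (σ h) (g c) := by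
  have hpoly : ∀ p : Polynomial F, HasVal P (σ (algebraMap _ _ p)) (g (p.eval R)) := by
    intro p
    induction p using Polynomial.induction_on with
    | C a => simpa [hσ a] using HasVal.const P (g a)
    | add p q hp hq => simpa using hp.add hq
    | monomial n a ih => simpa [pow_succ, mul_assoc] using ih.mul hX
  obtain ⟨p, q, hq, hpq, hv⟩ := hh
  have h1 := (hpoly p).of_mul_eq (hpoly q) (by simpa using hq)
    (by rw [← map_mul, hpq] : σ h * σ (algebraMap _ _ q) = _)
  rw [hv, map_mul, mul_div_assoc, div_self (by simpa using hq), mul_one] at h1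
  exact h1

theorem finite_not_regular (h : RatFunc F) : {P : F | ¬ ∃ c, HasVal P h c}.Finite := by
  refine (Polynomial.finite_setOfPred_isRoot h.denom_ne_zero).subset fun P hP => ?_
  by_contra hroot
  exact hP ⟨_, .of_denom_ne_zero hroot⟩

theorem finite_zeros {h : RatFunc F} (hh : h ≠ 0) : {P : F | HasVal P h 0}.Finite := by
  refine (Polynomial.finite_setOfPred_isRoot (RatFunc.num_ne_zero hh)).subset ?_
  rintro P ⟨p, q, hq, hpq, hv⟩
  have h1 : algebraMap (Polynomial F) (RatFunc F) (h.num * q) =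
      algebraMap _ _ (p * h.denom) := by
    rw [map_mul, map_mul, ← hpq]
    conv_rhs => enter [1, 1]; rw [← RatFunc.num_div_denom h]
    have := RatFunc.algebraMap_ne_zero h.denom_ne_zero
    field_simp
  have h2 := congrArg (Polynomial.eval P) (RatFunc.algebraMap_injective F h1)
  rw [Polynomial.eval_mul, Polynomial.eval_mul, hv, zero_mul, zero_mul] at h2
  exact (mul_eq_zero.1 h2).resolve_right hq

/-- A nonconstant rational function takes all but finitely many values outside a given finite
set. -/
theorem exists_finite_forall_exists_hasVal [IsAlgClosed F] {u : RatFunc F}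
    (hu : ¬ ∃ c, u = RatFunc.C c) {B : Set F} (hB : B.Finite) :
    ∃ S : Set F, S.Finite ∧ ∀ u₀ ∉ S, ∃ P ∉ B, HasVal P u u₀ := by
  have hsub : {a : F | (u.num - Polynomial.C a * u.denom).natDegree = 0}.Subsingleton := by
    intro a ha b hb
    by_contra hab
    apply hu
    rw [RatFunc.eq_C_iff]
    have hd : u.denom.natDegree = 0 := by
      have h1 : Polynomial.C (b - a) * u.denom = (u.num - Polynomial.C a * u.denom) -
          (u.num - Polynomial.C b * u.denom) := by rw [map_sub]; ring
      rw [← Polynomial.natDegree_C_mul (sub_ne_zero.2 (Ne.symm hab)), h1]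
      have := Polynomial.natDegree_sub_le (u.num - Polynomial.C a * u.denom)
        (u.num - Polynomial.C b * u.denom)
      rw [ha, hb] at this
      simpa using this
    refine ⟨?_, hd⟩
    have h1 : u.num = (u.num - Polynomial.C a * u.denom) + Polynomial.C a * u.denom := by ring
    rw [h1]
    have := Polynomial.natDegree_add_le (u.num - Polynomial.C a * u.denom)
      (Polynomial.C a * u.denom)
    have h2 := Polynomial.natDegree_C_mul_le a u.denom
    rw [Set.mem_ofPred_eq] at ha
    omega
  refine ⟨(⋃ P ∈ B, {c | HasVal P u c}) ∪
    {a : F | (u.num - Polynomial.C a * u.denom).natDegree = 0}, ?_, fun u₀ hu₀ => ?_⟩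
  · refine (hB.biUnion fun P _ => ?_).union hsub.finite
    exact Set.Subsingleton.finite fun c hc d hd => hc.unique hd
  · simp only [Set.mem_union, Set.mem_iUnion, Set.mem_ofPred_eq, not_or, not_exists] at hu₀
    obtain ⟨P, hP⟩ := IsAlgClosed.exists_root (u.num - Polynomial.C u₀ * u.denom)
      (fun h => hu₀.2 (Polynomial.natDegree_eq_zero_iff_degree_le_zero.2 h.le))
    have hP' : u.num.eval P = u₀ * u.denom.eval P := by
      simpa [sub_eq_zero] using hP
    have hd : u.denom.eval P ≠ 0 := by
      intro hd
      obtain ⟨a, b, hab⟩ := u.isCoprime_num_denom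
      simpa [hP', hd] using congrArg (Polynomial.eval P) hab
    have hval : HasVal P u u₀ := by
      have := HasVal.of_denom_ne_zero hd
      rwa [hP', mul_div_assoc, div_self hd, mul_one] at this
    exact ⟨P, fun hPB => hu₀.1 P hPB hval, hval⟩

/-! ### Semilinear automorphisms fixing a given function -/

/-- The ring automorphisms of `F(t)` which fix `f` and act on the constants through `g`. -/
def lifts (f : RatFunc F) (g : F → F) : Set (RatFunc F ≃+* RatFunc F) :=
  {σ | IsSemilin g σ ∧ σ f = f}

theorem lifts_mul {f : RatFunc F} {g h : F → F} {σ τ : RatFunc F ≃+* RatFunc F}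
    (hσ : σ ∈ lifts f g) (hτ : τ ∈ lifts f h) : σ * τ ∈ lifts f (g ∘ h) :=
  ⟨fun a => by rw [RingAut.mul_apply, hτ.1, hσ.1]; rfl, by rw [RingAut.mul_apply, hτ.2, hσ.2]⟩

theorem lifts_inv_mul {f : RatFunc F} {g : F → F} {σ τ : RatFunc F ≃+* RatFunc F}
    (hσ : σ ∈ lifts f g) (hτ : τ ∈ lifts f g) : σ⁻¹ * τ ∈ lifts f id := by
  refine ⟨fun a => ?_, ?_⟩
  · rw [RingAut.mul_apply, hτ.1, ← hσ.1]; exact σ.symm_apply_apply _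
  · rw [RingAut.mul_apply, hτ.2]; nth_rw 1 [← hσ.2]; exact σ.symm_apply_apply _

theorem lifts_inv {f : RatFunc F} {g : F ≃+* F} {σ : RatFunc F ≃+* RatFunc F}
    (hσ : σ ∈ lifts f g) : σ⁻¹ ∈ lifts f g.symm := by
  refine ⟨fun a => σ.injective ((σ.apply_symm_apply _).trans ?_),
    σ.injective ((σ.apply_symm_apply _).trans hσ.2.symm)⟩
  rw [hσ.1, g.apply_symm_apply]

theorem lifts_conj {f : RatFunc F} {g : F → F} {σ τ : RatFunc F ≃+* RatFunc F}
    (hσ : σ ∈ lifts f g) (hτ : τ ∈ lifts f id) : σ⁻¹ * (τ * σ) ∈ lifts f id :=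
  lifts_inv_mul hσ (show τ * σ ∈ lifts f (id ∘ g) from lifts_mul hτ hσ)

theorem one_mem_lifts (f : RatFunc F) : 1 ∈ lifts f id := ⟨fun _ => rfl, rfl⟩

theorem lifts_nonempty {f : RatFunc F} (g : F ≃ₐ[M] F) (h : RatCovIso (galRat g f) f) :
    (lifts f g).Nonempty := by
  obtain ⟨m, hm, hmf⟩ := h
  obtain ⟨σ, hσ, hX⟩ := exists_semilin_equiv (g : F ≃+* F) hm
  obtain ⟨τ, hτ, hX'⟩ := exists_semilin (RingHom.id F) hm.not_const
  refine ⟨σ, hσ, ?_⟩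
  have h1 := IsSemilin.ratComp_galRat (g := g) (σ := (σ : RatFunc F →+* RatFunc F)) (τ := τ)
    hσ hτ (by rw [hX']; exact hX.symm) f
  have h2 : σ f = ratComp (galRat g f) (σ RatFunc.X) := h1.symm
  rw [h2, hX, hmf]

theorem finite_lifts_id {f : RatFunc F} (hf : ¬ ∃ c, f = RatFunc.C c) : (lifts f id).Finite := by
  have hfin : FiniteDimensional (IntermediateField.adjoin F {f}) (RatFunc F) := by
    apply FiniteDimensional.of_finrank_pos
    rw [RatFunc.finrank_eq_max_natDegree]
    rw [RatFunc.eq_C_iff] at hf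
    omega
  let toAlgEquiv : lifts f id → (RatFunc F ≃ₐ[IntermediateField.adjoin F {f}] RatFunc F) :=
    fun σ => AlgEquiv.ofRingEquiv (f := σ.1) fun x => by
      have hle : IntermediateField.adjoin F {f} ≤
          (AlgHom.equalizer ({ (σ.1 : RatFunc F →+* RatFunc F) with
            commutes' := fun a => σ.2.1 a } : RatFunc F →ₐ[F] RatFunc F)
            (AlgHom.id F (RatFunc F))).toIntermediateField
              (fun x hx => by
                rw [AlgHom.mem_equalizer] at hx ⊢
                rw [map_inv₀, hx, map_inv₀]) := by
        rw [IntermediateField.adjoin_simple_le_iff]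
        exact σ.2.2
      exact hle x.2
  have : Finite (lifts f id) := Finite.of_injective toAlgEquiv fun σ τ h => by
    ext x
    exact DFunLike.congr_fun h x
  exact Set.toFinite _

/-- Lüroth's theorem for the field of invariants of `lifts f id`. -/
theorem exists_semilin_range {f : RatFunc F} (hf : ¬ ∃ c, f = RatFunc.C c) :
    ∃ φ : RatFunc F →+* RatFunc F, IsSemilin id φ ∧
      ∀ h, (∀ a ∈ lifts f id, a h = h) ↔ ∃ r, φ r = h := by
  let E : IntermediateField F (RatFunc F) :=
    { carrier := {h | ∀ a ∈ lifts f id, a h = h}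
      mul_mem' := fun hx hy a ha => by rw [map_mul, hx a ha, hy a ha]
      one_mem' := fun a _ => map_one a
      add_mem' := fun hx hy a ha => by rw [map_add, hx a ha, hy a ha]
      zero_mem' := fun a _ => map_zero a
      algebraMap_mem' := fun c a ha => ha.1 c
      inv_mem' := fun x hx a ha => by rw [map_inv₀, hx a ha] }
  have hE : E ≠ ⊥ := by
    intro h
    have h1 : f ∈ E := fun a ha => ha.2
    rw [h, IntermediateField.mem_bot] at h1
    obtain ⟨c, hc⟩ := h1
    exact hf ⟨c, hc.symm⟩
  refine ⟨E.val.toRingHom.comp (RatFunc.Luroth.algEquiv hE : RatFunc F →+* E), fun a => ?_,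
    fun h => ⟨fun hh => ?_, ?_⟩⟩
  · exact congrArg Subtype.val ((RatFunc.Luroth.algEquiv hE).commutes a)
  · exact ⟨(RatFunc.Luroth.algEquiv hE).symm ⟨h, hh⟩,
      congrArg Subtype.val ((RatFunc.Luroth.algEquiv hE).apply_symm_apply _)⟩
  · rintro ⟨r, rfl⟩
    exact (RatFunc.Luroth.algEquiv hE r).2

theorem map_mem_range {f : RatFunc F} {φ : RatFunc F →+* RatFunc F}
    (hφ : ∀ h, (∀ a ∈ lifts f id, a h = h) ↔ ∃ r, φ r = h) {g : F → F}
    {σ : RatFunc F ≃+* RatFunc F} (hσ : σ ∈ lifts f g) (r : RatFunc F) :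
    ∃ s, φ s = σ (φ r) := by
  rw [← hφ]
  intro a ha
  have h1 := (hφ _).2 ⟨r, rfl⟩ _ (lifts_conj hσ ha)
  rw [RingAut.mul_apply, RingAut.mul_apply] at h1
  exact σ.symm.injective (h1.trans (σ.symm_apply_apply _).symm)

/-- `w` is the image of `u` under the homography with matrix `c`. -/
def IsHomography (c : Matrix (Fin 2) (Fin 2) F) (u w : RatFunc F) : Prop :=
  w * (RatFunc.C (c 1 0) * u + RatFunc.C (c 1 1)) = RatFunc.C (c 0 0) * u + RatFunc.C (c 0 1)

theorem IsHomography.mul {c d : Matrix (Fin 2) (Fin 2) F} {u v : RatFunc F} {g : F →+* F}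
    {σ : RatFunc F →+* RatFunc F} (hσ : IsSemilin g σ) (hc : IsHomography c u (σ u))
    (hd : IsHomography d u v) : IsHomography (d.map g * c) u (σ v) := by
  have h1 := congrArg σ hd
  simp only [map_mul, map_add, hσ _] at h1
  simp only [IsHomography, Matrix.mul_apply, Fin.sum_univ_two, Matrix.map_apply, map_mul,
    map_add] at hc ⊢
  linear_combination (RatFunc.C (c 1 0) * u + RatFunc.C (c 1 1)) * h1 +
    (RatFunc.C (g (d 0 0)) - σ v * RatFunc.C (g (d 1 0))) * hc

theorem IsHomography.eq_smul {c d : Matrix (Fin 2) (Fin 2) F} {u w : RatFunc F}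
    (hu : ¬ ∃ a, u = RatFunc.C a) (hc : IsHomography c u w) (hd : IsHomography d u w)
    (hdet : c.det ≠ 0) : ∃ s : F, d = s • c := by
  have htr := transcendental_iff.1 (RatFunc.transcendental_of_ne_C u hu)
  have h0 := htr ((Polynomial.C (d 0 0) * Polynomial.X + Polynomial.C (d 0 1)) *
      (Polynomial.C (c 1 0) * Polynomial.X + Polynomial.C (c 1 1)) -
      (Polynomial.C (c 0 0) * Polynomial.X + Polynomial.C (c 0 1)) *
      (Polynomial.C (d 1 0) * Polynomial.X + Polynomial.C (d 1 1))) (by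
    simp only [map_mul, map_sub, map_add, Polynomial.aeval_C, Polynomial.aeval_X,
      RatFunc.algebraMap_eq_C]
    rw [← hc, ← hd]; ring)
  have h1 : Polynomial.C (d 0 0 * c 1 0 - c 0 0 * d 1 0) * Polynomial.X ^ 2 +
      Polynomial.C (d 0 0 * c 1 1 + d 0 1 * c 1 0 - c 0 0 * d 1 1 - c 0 1 * d 1 0) * Polynomial.X +
      Polynomial.C (d 0 1 * c 1 1 - c 0 1 * d 1 1) = 0 := by
    rw [← h0]
    simp only [map_sub, map_mul, map_add]
    ring
  have hcoeff : ∀ x y z : F, Polynomial.C x * Polynomial.X ^ 2 + Polynomial.C y * Polynomial.X +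
      Polynomial.C z = 0 → x = 0 ∧ y = 0 ∧ z = 0 := fun x y z h =>
    ⟨by simpa [Polynomial.coeff_X, Polynomial.coeff_C] using congrArg (Polynomial.coeff · 2) h,
      by simpa [Polynomial.coeff_C] using congrArg (Polynomial.coeff · 1) h,
      by simpa using congrArg (Polynomial.coeff · 0) h⟩
  obtain ⟨e2, e1, e0⟩ := hcoeff _ _ _ h1
  refine ⟨(c 1 1 * d 0 0 - c 0 1 * d 1 0) / c.det, ?_⟩
  have h2 : c.det • d = (c 1 1 * d 0 0 - c 0 1 * d 1 0) • c := by
    rw [Matrix.det_fin_two]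
    ext i j
    fin_cases i <;> fin_cases j <;>
      simp only [Matrix.smul_apply, smul_eq_mul, Fin.zero_eta, Fin.mk_one]
    · linear_combination -c 0 1 * e2
    · linear_combination -c 0 1 * e1 + c 0 0 * e0
    · linear_combination -c 1 1 * e2
    · linear_combination -c 1 1 * e1 + c 1 0 * e0
  rw [div_eq_inv_mul, mul_smul, ← h2, smul_smul, inv_mul_cancel₀ hdet, one_smul]

/-- The lifts of `g` all act on the generator `φ t` of the field of invariants by one and the same
homography. -/
theorem exists_homography_of_lifts {f : RatFunc F} {φ : RatFunc F →+* RatFunc F} (hid : IsSemilin id φ)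
    (hφ : ∀ h, (∀ a ∈ lifts f id, a h = h) ↔ ∃ r, φ r = h) {g : F ≃+* F}
    (hg : (lifts f g).Nonempty) :
    ∃ c : Matrix (Fin 2) (Fin 2) F, c.det ≠ 0 ∧
      ∀ σ ∈ lifts f g, IsHomography c (φ RatFunc.X) (σ (φ RatFunc.X)) := by
  obtain ⟨σ, hσ⟩ := hg
  choose τ hτ using map_mem_range hφ hσ
  let τ' : RatFunc F →+* RatFunc F :=
    { toFun := τ
      map_one' := φ.injective (by rw [hτ, map_one, map_one])
      map_zero' := φ.injective (by rw [hτ, map_zero, map_zero])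
      map_add' := fun x y => φ.injective (by rw [hτ, map_add, map_add, map_add, hτ, hτ])
      map_mul' := fun x y => φ.injective (by rw [hτ, map_mul, map_mul, map_mul, hτ, hτ]) }
  have hsemi : IsSemilin (g : F →+* F) τ' := fun a => φ.injective (by
    rw [hid]
    exact (hτ _).trans ((congrArg σ (hid a)).trans (hσ.1 a)))
  have hsurj : Function.Surjective τ' := by
    intro s
    obtain ⟨r, hr⟩ := map_mem_range hφ (lifts_inv hσ) s
    exact ⟨r, φ.injective ((hτ r).trans ((congrArg σ hr).trans (σ.apply_symm_apply _)))⟩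
  obtain ⟨a, b, c, d, hdet, hX⟩ := hsemi.isMobius hsurj
  have hden : RatFunc.C c * RatFunc.X + RatFunc.C d ≠ (0 : RatFunc F) :=
    C_mul_X_add_C_ne_zero (by by_contra! h; exact hdet (by rw [h.1, h.2]; ring))
  rw [eq_div_iff hden] at hX
  refine ⟨!![a, b; c, d], by rwa [Matrix.det_fin_two_of], fun σ' hσ' => ?_⟩
  have h1 : σ' (φ RatFunc.X) = σ (φ RatFunc.X) := by
    have := (hφ _).2 ⟨RatFunc.X, rfl⟩ _ (lifts_inv_mul hσ hσ')
    rw [RingAut.mul_apply] at this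
    exact (σ.apply_symm_apply _).symm.trans (congrArg σ this)
  have h2 := congrArg φ hX
  simp only [map_mul, map_add, hid _, id] at h2
  rw [h1, ← hτ]
  exact h2

/-- If the image of `P` in the quotient line is preserved by `g`, then some lift of `g` preserves
`P` itself. -/
theorem exists_lift_hasVal {f : RatFunc F} (hf : ¬ ∃ c, f = RatFunc.C c)
    {φ : RatFunc F →+* RatFunc F} (hid : IsSemilin id φ)
    (hφ : ∀ h, (∀ a ∈ lifts f id, a h = h) ↔ ∃ r, φ r = h) {P u₀ : F}
    (hreg : ∀ a ∈ lifts f id, ∃ c, HasVal P (a RatFunc.X) c) (hu₀ : HasVal P (φ RatFunc.X) u₀)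
    {g : F →+* F} {σ : RatFunc F ≃+* RatFunc F} (hσ : σ ∈ lifts f g)
    (hval : HasVal P (σ (φ RatFunc.X)) (g u₀)) :
    ∃ τ ∈ lifts f g, HasVal P (τ RatFunc.X) (g P) := by
  classical
  have hfin := finite_lifts_id hf
  let s := hfin.toFinset
  have hs : ∀ a, a ∈ s ↔ a ∈ lifts f id := fun a => hfin.mem_toFinset
  let N : RatFunc F := ∏ a ∈ s, (a RatFunc.X - RatFunc.C P)
  have hN : ∀ b ∈ lifts f id, b N = N := by
    intro b hb
    rw [map_prod]
    refine Finset.prod_nbij (b * ·) (fun a ha => ?_) (fun a _ a' _ h => mul_left_cancel h)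
      (fun a ha => ?_) fun a _ => ?_
    · exact (hs _).2 (lifts_mul hb ((hs a).1 ha))
    · exact ⟨b⁻¹ * a, (hs _).2 (lifts_inv_mul hb ((hs a).1 ha)), mul_inv_cancel_left b a⟩
    · rw [map_sub, hb.1]; rfl
  obtain ⟨r, hr⟩ := (hφ N).1 hN
  have hN0 : HasVal P N 0 := by
    refine HasVal.exists_prod_eq_zero (j := 1) (fun a ha => ?_) ((hs 1).2 (one_mem_lifts f)) ?_
    · obtain ⟨c, hc⟩ := hreg a ((hs a).1 ha)
      exact ⟨_, hc.sub (HasVal.const P P)⟩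
    · simpa using (HasVal.X P).sub (HasVal.const P P)
  have hid' : IsSemilin (RingHom.id F) φ := hid
  have hr0 : HasVal u₀ r 0 := by
    obtain ⟨c, hc⟩ | ⟨hr0, hinv⟩ := hasVal_or_inv u₀ r
    · have h1 := HasVal.semilin hid' (P := P) (R := u₀) hu₀ hc
      rw [hr] at h1
      rwa [← h1.unique hN0]
    · have h1 := HasVal.semilin hid' (P := P) (R := u₀) hu₀ hinv
      rw [map_inv₀, hr] at h1
      exact absurd h1 (not_hasVal_inv hN0 (by rwa [← hr, map_ne_zero]))
  have hcomp : IsSemilin g ((σ : RatFunc F →+* RatFunc F).comp φ) := fun a =>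
    (congrArg σ (hid a)).trans (hσ.1 a)
  have h1 := HasVal.semilin hcomp (P := P) (R := u₀) hval hr0
  rw [map_zero, RingHom.comp_apply, hr, RingHom.coe_coe, map_prod] at h1
  obtain ⟨a, ha, hav⟩ := h1.exists_of_prod_eq_zero
  refine ⟨σ * a, lifts_mul hσ ((hs a).1 ha), ?_⟩
  rw [map_sub, hσ.1] at hav
  exact hav.of_sub

theorem lift_unique {f : RatFunc F} {P : F}
    (hP : ∀ a ∈ lifts f id, HasVal P (a RatFunc.X - RatFunc.X) 0 → a = 1) {g : F →+* F}
    (hreg : ∀ a ∈ lifts f id, ∃ c, HasVal P (a RatFunc.X) c)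
    {σ τ : RatFunc F ≃+* RatFunc F} (hσ : σ ∈ lifts f g) (hτ : τ ∈ lifts f g)
    (hσP : HasVal P (σ RatFunc.X) (g P)) (hτP : HasVal P (τ RatFunc.X) (g P)) : σ = τ := by
  have ha := lifts_inv_mul hσ hτ
  obtain ⟨c, hc⟩ := hreg _ ha
  have hσ' : IsSemilin g (σ : RatFunc F →+* RatFunc F) := hσ.1
  have h1 := HasVal.semilin hσ' (P := P) (R := P) hσP hc
  have h2 : σ ((σ⁻¹ * τ) RatFunc.X) = τ RatFunc.X := σ.apply_symm_apply _
  rw [RingHom.coe_coe, h2] at h1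
  rw [g.injective (h1.unique hτP)] at hc
  have h3 := hP _ ha (by simpa using hc.sub (HasVal.X P))
  exact (inv_mul_eq_one.1 h3)

/-- There are an extension `L` of degree at most two and a point `P`, general with respect to the
automorphism group of the cover, which the automorphisms over `L` can be lifted to preserve. -/
theorem exists_quadratic_marking [IsGalois M F] [IsAlgClosed F] [Infinite M] {f : RatFunc F}
    (hf : ¬ ∃ c, f = RatFunc.C c) (hΓ : ∀ g : F ≃ₐ[M] F, (lifts f g).Nonempty) :
    ∃ L : IntermediateField M F, FiniteDimensional M L ∧ Module.finrank M L ≤ 2 ∧ ∃ P : F,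
      (∀ a ∈ lifts f id, ∃ c, HasVal P (a RatFunc.X) c) ∧
      (∀ a ∈ lifts f id, HasVal P (a RatFunc.X - RatFunc.X) 0 → a = 1) ∧
      ∀ g : F ≃ₐ[M] F, (∀ x ∈ L, g x = x) → ∃ σ ∈ lifts f g, HasVal P (σ RatFunc.X) (g P) := by
  obtain ⟨φ, hid, hφ⟩ := exists_semilin_range hf
  have hu : ¬ ∃ c, φ RatFunc.X = RatFunc.C c := by
    rintro ⟨c, hc⟩
    rw [← id_eq c, ← hid] at hc
    exact not_X_eq_C ⟨c, φ.injective hc⟩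
  have hmat := fun g : F ≃ₐ[M] F => exists_homography_of_lifts (g := (g : F ≃+* F)) hid hφ (hΓ g)
  choose c hdet hc using hmat
  have hmul : ∀ g h : F ≃ₐ[M] F, ∃ s : F, c (g * h) = s • ((c h).map g * c g) := by
    intro g h
    obtain ⟨σ, hσ⟩ := hΓ g
    obtain ⟨τ, hτ⟩ := hΓ h
    refine IsHomography.eq_smul hu (w := (σ * τ) (φ RatFunc.X)) ?_
      (hc (g * h) _ (show σ * τ ∈ lifts f (g ∘ h) from lifts_mul hσ hτ)) ?_
    · have hσ' : IsSemilin ((g : F ≃+* F) : F →+* F) (σ : RatFunc F →+* RatFunc F) := hσ.1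
      exact IsHomography.mul hσ' (hc g σ hσ) (hc h τ hτ)
    · rw [Matrix.det_mul]
      refine mul_ne_zero ?_ (hdet g)
      have : ((c h).map g).det = g (c h).det := (RingHom.map_det (g : F →+* F) (c h)).symm
      rw [this]
      exact (map_ne_zero _).2 (hdet h)
  obtain ⟨N₁, hN₁, hfix₁⟩ := exists_finiteDimensional_fixing (M := M) f
  obtain ⟨N₂, hN₂, hfix₂⟩ := exists_finiteDimensional_fixing (M := M) (φ RatFunc.X)
  have hN : ∀ g : F ≃ₐ[M] F, (∀ x ∈ N₁ ⊔ N₂, g x = x) → ∃ s : F, c g = s • 1 := by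
    intro g hg
    obtain ⟨σ, hσ, hX⟩ := exists_semilin_equiv_X (g : F ≃+* F)
    have h1 := hfix₁ g (σ : RatFunc F →+* RatFunc F)
      (fun x hx => hg x ((le_sup_left : N₁ ≤ N₁ ⊔ N₂) hx)) hσ hX
    have h2 := hfix₂ g (σ : RatFunc F →+* RatFunc F)
      (fun x hx => hg x ((le_sup_right : N₂ ≤ N₁ ⊔ N₂) hx)) hσ hX
    refine IsHomography.eq_smul hu (w := φ RatFunc.X) ?_ ?_ (by simp)
    · simp [IsHomography]
    · have h3 := hc g σ ⟨hσ, h1⟩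
      rwa [show σ (φ RatFunc.X) = φ RatFunc.X from h2] at h3
  have hfin := finite_lifts_id hf
  let B : Set F := (⋃ a ∈ lifts f id, {P | ¬ ∃ c, HasVal P (a RatFunc.X) c}) ∪
    ⋃ a ∈ lifts f id \ {1}, {P | HasVal P (a RatFunc.X - RatFunc.X) 0}
  have hB : B.Finite := by
    refine (hfin.biUnion fun a _ => finite_not_regular _).union
      (hfin.sdiff.biUnion fun a ha => finite_zeros fun h0 => ha.2 ?_)
    rw [sub_eq_zero] at h0
    have ha' : IsSemilin (RingHom.id F) (a : RatFunc F →+* RatFunc F) := ha.1.1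
    have h1' : IsSemilin (RingHom.id F) (RingHom.id (RatFunc F)) := fun _ => rfl
    exact RingEquiv.ext fun h => ha'.ext h1' h0 h
  obtain ⟨S, hS, hSP⟩ := exists_finite_forall_exists_hasVal hu hB
  obtain ⟨L, hL, hL2, u₀, hu₀, hg⟩ := exists_quadratic_point c hdet hmul (N₁ ⊔ N₂) hN hS
  obtain ⟨P, hPB, hPu⟩ := hSP u₀ hu₀
  simp only [B, Set.mem_union, Set.mem_iUnion, not_or, not_exists] at hPB
  have hreg : ∀ a ∈ lifts f id, ∃ c, HasVal P (a RatFunc.X) c := fun a ha => by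
    by_contra hcon
    exact hPB.1 a ha fun c hc => hcon ⟨c, hc⟩
  refine ⟨L, hL, hL2, P, hreg, fun a ha hv => ?_, fun g hgL => ?_⟩
  · by_contra hne
    exact hPB.2 a ⟨ha, hne⟩ hv
  · obtain ⟨σ, hσ⟩ := hΓ g
    obtain ⟨hne, hfix⟩ := hg g hgL
    have hval : HasVal P (σ (φ RatFunc.X)) (g u₀) := by
      have h1 := (((HasVal.const P (c g 0 0)).mul hPu).add (HasVal.const P (c g 0 1))).of_mul_eq
        (((HasVal.const P (c g 1 0)).mul hPu).add (HasVal.const P (c g 1 1))) hne (hc g σ hσ)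
      rwa [hfix, mul_div_assoc, div_self hne, mul_one] at h1
    exact exists_lift_hasVal (g := (g : F →+* F)) hf hid hφ hreg hPu hσ hval

/-- A semilinear automorphism compatible with the point `P` preserves the space of functions with
at most a simple pole at `P`. -/
theorem IsSemilin.map_inv_X_sub_C {g : F →+* F} {σ : RatFunc F →+* RatFunc F}
    (hσ : IsSemilin g σ) (hsurj : Function.Surjective σ) {P : F}
    (hP : HasVal P (σ RatFunc.X) (g P)) :
    ∃ k l : F, σ (RatFunc.X - RatFunc.C P)⁻¹ =
      RatFunc.C k + RatFunc.C l * (RatFunc.X - RatFunc.C P)⁻¹ := by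
  have hmob := hσ.isMobius hsurj
  have hnc := hmob.not_const
  obtain ⟨a, b, c, d, hdet, hX⟩ := hmob
  have hden : RatFunc.C c * RatFunc.X + RatFunc.C d ≠ (0 : RatFunc F) :=
    C_mul_X_add_C_ne_zero (by by_contra! h; exact hdet (by rw [h.1, h.2]; ring))
  rw [eq_div_iff hden] at hX
  have hval : g P * (c * P + d) = a * P + b := by
    have h1 := hP.mul (((HasVal.const P c).mul (HasVal.X P)).add (HasVal.const P d))
    rw [hX] at h1
    exact h1.unique (((HasVal.const P a).mul (HasVal.X P)).add (HasVal.const P b))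
  have hfac : (σ RatFunc.X - RatFunc.C (g P)) * (RatFunc.C c * RatFunc.X + RatFunc.C d) =
      RatFunc.C (a - g P * c) * (RatFunc.X - RatFunc.C P) := by
    have h1 := congrArg (RatFunc.C (K := F)) hval
    simp only [map_add, map_mul, map_sub] at h1 ⊢
    linear_combination hX - h1
  have hk : a - g P * c ≠ 0 := by
    intro h0
    rw [h0, map_zero, zero_mul, mul_eq_zero, or_iff_left hden, sub_eq_zero] at hfac
    exact hnc ⟨_, hfac⟩
  have hkC : RatFunc.C (a - g P * c) ≠ 0 := (map_ne_zero _).2 hk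
  have hXP := X_sub_C_ne_zero P
  refine ⟨(a - g P * c)⁻¹ * c, (a - g P * c)⁻¹ * (c * P + d), ?_⟩
  rw [map_inv₀, map_sub, hσ]
  refine inv_eq_of_mul_eq_one_right ?_
  simp only [map_mul, map_add, map_inv₀] at hfac ⊢
  have h1 : (RatFunc.X - RatFunc.C P) * (RatFunc.X - RatFunc.C P)⁻¹ = 1 := mul_inv_cancel₀ hXP
  have h2 : RatFunc.C (a - g P * c) * (RatFunc.C (a - g P * c))⁻¹ = 1 := mul_inv_cancel₀ hkC
  linear_combination (RatFunc.C (a - g P * c))⁻¹ * (RatFunc.X - RatFunc.C P)⁻¹ * hfac +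
    RatFunc.C (a - g P * c) * (RatFunc.C (a - g P * c))⁻¹ * h1 + h2 -
    (σ RatFunc.X - RatFunc.C (g P)) * (RatFunc.C (a - g P * c))⁻¹ * RatFunc.C c * h1

/-- A cover with a compatible system of lifts preserving a general point `P` descends. -/
theorem exists_ratCovIso_of_marking [IsGalois M F] {f : RatFunc F} {P : F}
    (hreg : ∀ a ∈ lifts f id, ∃ c, HasVal P (a RatFunc.X) c)
    (hP : ∀ a ∈ lifts f id, HasVal P (a RatFunc.X - RatFunc.X) 0 → a = 1)
    (hlift : ∀ g : F ≃ₐ[M] F, ∃ σ ∈ lifts f g, HasVal P (σ RatFunc.X) (g P)) :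
    ∃ f' : RatFunc F, RatCovIso f f' ∧ (∀ n, f'.num.coeff n ∈ Set.range (algebraMap M F)) ∧
      ∀ n, f'.denom.coeff n ∈ Set.range (algebraMap M F) := by
  choose σ hσ hσP using hlift
  have huniq : ∀ (g : F ≃ₐ[M] F) (τ), τ ∈ lifts f g → HasVal P (τ RatFunc.X) (g P) → σ g = τ :=
    fun g τ hτ hτP => lift_unique (g := (g : F →+* F)) hP hreg (hσ g) hτ (hσP g) hτP
  have hsemi : ∀ g : F ≃ₐ[M] F, IsSemilin (g : F →+* F) (σ g : RatFunc F →+* RatFunc F) :=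
    fun g => (hσ g).1
  have hmul : ∀ g h, σ (g * h) = σ g * σ h := fun g h =>
    huniq (g * h) _ (show σ g * σ h ∈ lifts f (g ∘ h) from lifts_mul (hσ g) (hσ h))
      (HasVal.semilin (hsemi g) (hσP g) (hσP h))
  let v : RatFunc F := (RatFunc.X - RatFunc.C P)⁻¹
  let V : Submodule F (RatFunc F) := Submodule.span F {1, v}
  let ρ : (F ≃ₐ[M] F) → RatFunc F →+ RatFunc F := fun g => (σ g : RatFunc F →+* RatFunc F)
  have hρ : ∀ g (a : F) w, ρ g (a • w) = g a • ρ g w := fun g a w => by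
    rw [RatFunc.smul_eq_C_mul, RatFunc.smul_eq_C_mul]
    exact (map_mul (σ g) _ _).trans (by rw [(hσ g).1]; rfl)
  have hmem : ∀ w, w ∈ V ↔ ∃ a b : F, RatFunc.C a + RatFunc.C b * v = w := fun w => by
    simp only [V, Submodule.mem_span_pair, RatFunc.smul_eq_C_mul, mul_one]
  have hV : ∀ g, ∀ w ∈ V, ρ g w ∈ V := by
    intro g w hw
    obtain ⟨a, b, rfl⟩ := (hmem w).1 hw
    obtain ⟨k, l, hkl⟩ := (hsemi g).map_inv_X_sub_C (σ g).surjective (hσP g)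
    refine (hmem _).2 ⟨g a + g b * k, g b * l, ?_⟩
    have h1 : ρ g (RatFunc.C a + RatFunc.C b * v) =
        RatFunc.C (g a) + RatFunc.C (g b) * (RatFunc.C k + RatFunc.C l * v) := by
      rw [← hkl, ← (hσ g).1 a, ← (hσ g).1 b]
      exact (map_add (σ g) _ _).trans (congrArg _ (map_mul (σ g) _ _))
    rw [h1, map_add, map_mul, map_mul]
    ring
  obtain ⟨N, hN, hfix⟩ := exists_finiteDimensional_fixing (M := M) f
  have : FiniteDimensional M (IntermediateField.adjoin M {P}) :=
    IntermediateField.adjoin.finiteDimensional (Algebra.IsIntegral.isIntegral P)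
  have hvV : v ∈ V := Submodule.subset_span (by simp)
  have hspan := mem_span_invariants ρ hρ
    (fun g h w => by simp only [ρ]; rw [hmul]; rfl) V hV
    (N ⊔ IntermediateField.adjoin M {P}) hvV fun g hg => by
      obtain ⟨τ, hτ, hX⟩ := exists_semilin_equiv_X (g : F ≃+* F)
      have h1 := hfix g (τ : RatFunc F →+* RatFunc F)
        (fun x hx => hg x ((le_sup_left : N ≤ _) hx)) hτ hX
      have hgP : g P = P := hg P ((le_sup_right : IntermediateField.adjoin M {P} ≤ _)
        (IntermediateField.mem_adjoin_simple_self M P))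
      have h2 := huniq g τ ⟨hτ, h1⟩ (by rw [hX, hgP]; exact HasVal.X P)
      have h3 : τ v = v := by
        rw [map_inv₀, map_sub, hX, hτ]
        exact congrArg (fun c => (RatFunc.X - RatFunc.C c)⁻¹) hgP
      exact (congrArg (fun τ : RatFunc F ≃+* RatFunc F => τ v) h2).trans h3
  obtain ⟨T, hTV, hT, hT1⟩ : ∃ T ∈ V, (∀ g, ρ g T = T) ∧ T ∉ Submodule.span F {1} := by
    by_contra! hcon
    have hle : Submodule.span F {w | w ∈ V ∧ ∀ g, ρ g w = w} ≤ Submodule.span F {1} :=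
      Submodule.span_le.2 fun w hw => hcon w hw.1 hw.2
    obtain ⟨a, ha⟩ := Submodule.mem_span_singleton.1 (hle hspan)
    rw [RatFunc.smul_eq_C_mul, mul_one] at ha
    refine not_X_eq_C ⟨a⁻¹ + P, ?_⟩
    rw [map_add, map_inv₀, ha, inv_inv, sub_add_cancel]
  obtain ⟨a, b, rfl⟩ := (hmem T).1 hTV
  have hb : b ≠ 0 := by
    rintro rfl
    exact hT1 (Submodule.mem_span_singleton.2 ⟨a, by simp [RatFunc.smul_eq_C_mul]⟩)
  have hmob : IsMobius (RatFunc.C a + RatFunc.C b * v) := by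
    refine ⟨a, b - a * P, 1, -P, fun h => hb (by linear_combination -h), ?_⟩
    have hXP := X_sub_C_ne_zero P
    rw [map_one, one_mul, map_neg, ← sub_eq_add_neg, eq_div_iff hXP, add_mul, mul_assoc,
      inv_mul_cancel₀ hXP, map_sub, map_mul]
    ring
  obtain ⟨ψ, hψ, hψX⟩ := exists_semilin_equiv (RingEquiv.refl F) hmob
  have hψ' : IsSemilin (RingHom.id F) (ψ.symm : RatFunc F →+* RatFunc F) := fun c =>
    ψ.injective ((ψ.apply_symm_apply _).trans (hψ c).symm)
  refine ⟨ψ.symm f, ⟨ψ.symm RatFunc.X, hψ'.isMobius ψ.symm.surjective,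
    IsSemilin.ratComp_eq (σ := (ψ.symm : RatFunc F →+* RatFunc F)) hψ' f⟩, ?_⟩
  have hfixed : ∀ g : F ≃ₐ[M] F, (ψ.symm f).num.map (g : F →+* F) = (ψ.symm f).num ∧
      (ψ.symm f).denom.map (g : F →+* F) = (ψ.symm f).denom := by
    intro g
    let τ : RatFunc F ≃+* RatFunc F := (ψ.trans (σ g)).trans ψ.symm
    have hτ : IsSemilin (g : F →+* F) (τ : RatFunc F →+* RatFunc F) := fun c => by
      refine (congrArg (fun x => ψ.symm (σ g x)) (hψ c)).trans ?_
      exact (congrArg ψ.symm ((hσ g).1 c)).trans (hψ' _)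
    refine hτ.map_num_denom ?_ ?_
    · refine (congrArg (fun x => ψ.symm (σ g x)) hψX).trans ?_
      refine (congrArg ψ.symm (hT g)).trans ?_
      rw [← hψX, ψ.symm_apply_apply]
    · refine (congrArg (fun x => ψ.symm (σ g x)) (ψ.apply_symm_apply f)).trans ?_
      exact congrArg ψ.symm (hσ g).2
  refine ⟨fun n => ?_, fun n => ?_⟩ <;>
    refine (InfiniteGalois.mem_range_algebraMap_iff_fixed (k := M) _).2 fun g => ?_
  · simpa using congrArg (Polynomial.coeff · n) (hfixed g).1
  · simpa using congrArg (Polynomial.coeff · n) (hfixed g).2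

/-- Let `F` be an algebraically closed field of characteristic zero,
algebraic over `M`, and let `f : P¹_F → P¹_F` be a (nonconstant) cover whose field of
moduli is `M`, i.e. `g_* f ≅ f` for every `g ∈ Gal(F/M)`.  Then there is an extension
`L ⊇ M` with `[L : M] ≤ 2` over which `f` is defined. -/
theorem genus_zero_cover_defined_over_quadratic_extension
    [IsAlgClosed F] [CharZero F] [Algebra.IsAlgebraic M F]
    (f : RatFunc F) (hnc : ∀ a : F, f ≠ RatFunc.C a)
    (hM : ∀ g : F ≃ₐ[M] F, RatCovIso (galRat g f) f) :
    ∃ L : IntermediateField M F, FiniteDimensional M L ∧ Module.finrank M L ≤ 2 ∧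
      RatDefinedOver L f := by
  have : CharZero M := ⟨fun m n h => Nat.cast_injective (R := F) (by
    simpa using congrArg (algebraMap M F) h)⟩
  have : Normal M F := normal_iff.2 fun x =>
    ⟨Algebra.IsIntegral.isIntegral x, IsAlgClosed.splits _⟩
  have : IsGalois M F := {}
  obtain ⟨L, hL, hL2, P, hreg, hP, hlift⟩ := exists_quadratic_marking (M := M)
    (fun ⟨c, hc⟩ => hnc c hc) fun g => lifts_nonempty g (hM g)
  obtain ⟨f', hiso, hnum, hdenom⟩ := exists_ratCovIso_of_marking (M := L) hreg hP fun g =>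
    hlift (g.restrictScalars M) fun x hx => g.commutes ⟨x, hx⟩
  refine ⟨L, hL, hL2, f', hiso, fun n => ?_, fun n => ?_⟩
  · obtain ⟨x, hx⟩ := hnum n
    exact hx ▸ x.2
  · obtain ⟨x, hx⟩ := hdenom n
    exact hx ▸ x.2

end
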